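/- Let G be a connected undirected graph with customer set C contained in the facility set, and let G* be the graph obtained from G by repeatedly deleting non-customer leaves and deleting the internal vertices of leaf 2-connected components containing no internal customer. Suppose G* contains at least one leaf or leaf component. Let F* consist of all leaves of G* together with one internal customer from each remaining leaf component of G*. Then F* is an unconstrained path-disjoint cover of C, and every unconstrained path-disjoint cover of C has size at least |F*|; that is, F* is a minimum-cardinality unconstrained path-disjoint cover. -/

import Mathlib

/-- `IsDiPath A a b p` asserts that the list of vertices `p` is a simple directed
path from `a` to `b` in the directed graph with arc relation `A`. -/
def IsDiPath {V : Type*} (A : V → V → Prop) (a b : V) (p : List V) : Prop :=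
  p.head? = some a ∧ p.getLast? = some b ∧ List.Chain' A p ∧ p.Nodup

/-- The arcs traversed by a path: the list of consecutive pairs of vertices. -/
def pathArcs {V : Type*} (p : List V) : List (V × V) :=
  p.zip p.tail

/-- The total weight of a path: the sum of the weights of its arcs. -/
def pathWeight {V : Type*} (w : V → V → ℝ) (p : List V) : ℝ :=
  ((p.zip p.tail).map fun e => w e.1 e.2).sum

/-- `p` is a shortest (minimum total weight) directed path from `a` to `b`. -/
def IsShortestDiPath {V : Type*} (A : V → V → Prop) (w : V → V → ℝ) (a b : V)
    (p : List V) : Prop :=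
  IsDiPath A a b p ∧ ∀ q, IsDiPath A a b q → pathWeight w p ≤ pathWeight w q

/-- `S` induces a connected subgraph of `G`: `S` is nonempty, and any two vertices of
`S` are joined by a path all of whose vertices lie in `S`. -/
def ConnOn {V : Type*} (G : SimpleGraph V) (S : Set V) : Prop :=
  S.Nonempty ∧ ∀ u ∈ S, ∀ v ∈ S, ∃ p : List V, IsDiPath G.Adj u v p ∧ ∀ x ∈ p, x ∈ S

/-- `v` is a leaf of the subgraph of `G` induced on `S`: it has exactly one
neighbour within `S`. -/
def LeafOn {V : Type*} (G : SimpleGraph V) (S : Set V) (v : V) : Prop :=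
  v ∈ S ∧ {u ∈ S | G.Adj v u}.ncard = 1

/-- `v` is an articulation point of the subgraph of `G` induced on `S`: deleting it
disconnects that subgraph. -/
def ArtOn {V : Type*} (G : SimpleGraph V) (S : Set V) (v : V) : Prop :=
  v ∈ S ∧ (S \ {v}).Nonempty ∧ ¬ ConnOn G (S \ {v})

/-- `B` induces a 2-connected (biconnected) subgraph of `G`: it is connected and
remains connected after deleting any single vertex. -/
def BiconnOn {V : Type*} (G : SimpleGraph V) (B : Set V) : Prop :=
  ConnOn G B ∧ ∀ v ∈ B, ConnOn G (B \ {v})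

/-- `B` is a maximal 2-connected component (a block) of the subgraph of `G`
induced on `S`. -/
def BlockOn {V : Type*} (G : SimpleGraph V) (S B : Set V) : Prop :=
  B ⊆ S ∧ BiconnOn G B ∧ ∀ B', B ⊆ B' → B' ⊆ S → BiconnOn G B' → B' = B

/-- `B` is a leaf component of the subgraph of `G` induced on `S`: a maximal
2-connected component containing exactly one articulation point. -/
def LeafCompOn {V : Type*} (G : SimpleGraph V) (S B : Set V) : Prop :=
  BlockOn G S B ∧ ∃! v, v ∈ B ∧ ArtOn G S v

/-- `x` is an internal vertex of the component `B` (in the subgraph induced on `S`):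
a vertex of `B` that is not an articulation point. -/
def InternalOn {V : Type*} (G : SimpleGraph V) (S B : Set V) (x : V) : Prop :=
  x ∈ B ∧ ¬ ArtOn G S x

/-- One pruning step: delete a non-customer leaf, or delete all internal vertices of
a leaf component having no internal customer. -/
inductive PruneStep {V : Type*} (G : SimpleGraph V) (C : Set V) : Set V → Set V → Prop
  | leaf {S : Set V} {v : V} : v ∈ S → v ∉ C → LeafOn G S v →
      PruneStep G C S (S \ {v})
  | comp {S B : Set V} : LeafCompOn G S B →
      (∀ x, InternalOn G S B x → x ∉ C) →
      PruneStep G C S (S \ {x | InternalOn G S B x})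

/-- `Vstar` is the vertex set of the pruned graph `G*`: it is obtained from the full
vertex set by repeatedly applying pruning steps, until none applies. -/
def Pruned {V : Type*} (G : SimpleGraph V) (C Vstar : Set V) : Prop :=
  Relation.ReflTransGen (PruneStep G C) Set.univ Vstar ∧
    ∀ S, ¬ PruneStep G C Vstar S

/-- `F'` is an unconstrained path-disjoint cover of the customer set `C`: every
customer not in `F'` has two (not necessarily shortest) paths to two distinct
members of `F'` whose only common vertex is the customer itself. -/
def UPDCover {V : Type*} (G : SimpleGraph V) (C F' : Set V) : Prop :=
  ∀ c ∈ C, c ∉ F' → ∃ f₁ ∈ F', ∃ f₂ ∈ F', f₁ ≠ f₂ ∧ f₁ ≠ c ∧ f₂ ≠ c ∧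
    ∃ p q, IsDiPath G.Adj c f₁ p ∧ IsDiPath G.Adj c f₂ q ∧ ∀ x ∈ p, x ∈ q → x = c

namespace PrunedCover

variable {V : Type*} {G : SimpleGraph V}

/-- `Reach G S u v`: there is a walk from `u` to `v` all of whose edges have both ends in `S`. -/
def Reach (G : SimpleGraph V) (S : Set V) : V → V → Prop :=
  Relation.ReflTransGen fun x y => G.Adj x y ∧ x ∈ S ∧ y ∈ S

theorem Reach.refl (S : Set V) (u : V) : Reach G S u u := Relation.ReflTransGen.refl

theorem Reach.trans {S : Set V} {u v w : V} (h : Reach G S u v) (h' : Reach G S v w) :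
    Reach G S u w := Relation.ReflTransGen.trans h h'

theorem Reach.single {S : Set V} {u v : V} (h : G.Adj u v) (hu : u ∈ S) (hv : v ∈ S) :
    Reach G S u v := Relation.ReflTransGen.single ⟨h, hu, hv⟩

theorem Reach.symm {S : Set V} {u v : V} (h : Reach G S u v) : Reach G S v u := by
  induction h with
  | refl => exact Reach.refl _ _
  | tail _ h ih => exact (Reach.single h.1.symm h.2.2 h.2.1).trans ih

theorem Reach.mono {S T : Set V} {u v : V} (h : Reach G S u v) (hST : S ⊆ T) :
    Reach G T u v :=
  Relation.ReflTransGen.mono (p := fun x y => G.Adj x y ∧ x ∈ T ∧ y ∈ T)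
    (fun _ _ h => ⟨h.1, hST h.2.1, hST h.2.2⟩) _ _ h

/-- A set containing the start of a walk and closed under steps inside `S` contains its end. -/
theorem Reach.mem_of_closed {S X : Set V} {u v : V} (h : Reach G S u v) (hu : u ∈ X)
    (hX : ∀ x ∈ X, x ∈ S → ∀ y ∈ S, G.Adj x y → y ∈ X) : v ∈ X := by
  induction h with
  | refl => exact hu
  | tail _ h ih => exact hX _ ih h.2.1 _ h.2.2 h.1

theorem Reach.mem {S : Set V} {u v : V} (h : Reach G S u v) (hu : u ∈ S) : v ∈ S :=
  h.mem_of_closed hu fun _ _ _ _ hy _ => hy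

/-- Walks are mapped to walks by maps contracting or preserving each edge. -/
theorem Reach.map {S T : Set V} {u v : V} (h : Reach G S u v) (f : V → V)
    (hf : ∀ x ∈ S, ∀ y ∈ S, G.Adj x y →
      f x = f y ∨ (G.Adj (f x) (f y) ∧ f x ∈ T ∧ f y ∈ T)) :
    Reach G T (f u) (f v) := by
  induction h with
  | refl => exact Reach.refl _ _
  | tail _ h ih =>
    rcases hf _ h.2.1 _ h.2.2 h.1 with e | e
    · exact e ▸ ih
    · exact ih.trans (Relation.ReflTransGen.single e)

/-- A walk inside `S` stays inside the set of vertices reachable from its start. -/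
theorem Reach.component {S : Set V} {u v : V} (h : Reach G S u v) :
    Reach G {w | Reach G S u w} u v := by
  induction h with
  | refl => exact Reach.refl _ _
  | tail h h' ih =>
    exact ih.trans (Reach.single h'.1 h (h.trans (Reach.single h'.1 h'.2.1 h'.2.2)))

/-- A walk to `y` can be cut just before its first visit to `y`. -/
theorem Reach.exists_adj_of_ne {S : Set V} {u y : V} (h : Reach G S u y) (huy : u ≠ y) :
    ∃ z ∈ S \ {y}, Reach G (S \ {y}) u z ∧ G.Adj z y := by
  induction h using Relation.ReflTransGen.head_induction_on with
  | refl => exact absurd rfl huy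
  | @head a c h' h ih =>
    by_cases hc : c = y
    · subst hc
      exact ⟨a, ⟨h'.2.1, huy⟩, Reach.refl _ _, h'.1⟩
    · obtain ⟨z, hz, hcz, hzy⟩ := ih hc
      exact ⟨z, hz, (Reach.single (S := S \ {y}) h'.1 ⟨h'.2.1, huy⟩ ⟨h'.2.2, hc⟩).trans hcz, hzy⟩

theorem Reach.exists_walk {S : Set V} {u v : V} (h : Reach G S u v) (hu : u ∈ S) :
    ∃ p : G.Walk u v, ∀ x ∈ p.support, x ∈ S := by
  induction h using Relation.ReflTransGen.head_induction_on with
  | refl => exact ⟨SimpleGraph.Walk.nil, by simpa using hu⟩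
  | head h' h ih =>
    obtain ⟨p, hp⟩ := ih h'.2.2
    exact ⟨SimpleGraph.Walk.cons h'.1 p, by simpa using ⟨h'.2.1, hp⟩⟩

theorem Reach.exists_path {S : Set V} {u v : V} (h : Reach G S u v) (hu : u ∈ S) :
    ∃ p, IsDiPath G.Adj u v p ∧ ∀ x ∈ p, x ∈ S := by
  classical
  obtain ⟨p, hp⟩ := h.exists_walk hu
  refine ⟨p.bypass.support, ⟨?_, ?_, p.bypass.isChain_adj_support,
    p.bypass_isPath.support_nodup⟩, fun x hx => hp x (p.support_bypass_subset_support hx)⟩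
  · rw [List.head?_eq_some_head p.bypass.support_ne_nil, p.bypass.head_support]
  · rw [List.getLast?_eq_some_getLast p.bypass.support_ne_nil, p.bypass.getLast_support]

theorem reach_of_isChain {S : Set V} {a : V} {l : List V} (hl : (a :: l).IsChain G.Adj)
    (hS : ∀ x ∈ a :: l, x ∈ S) {z : V} (hz : z ∈ a :: l) : Reach G S a z := by
  induction l generalizing a with
  | nil => simp at hz; subst hz; exact Reach.refl _ _
  | cons b l ih =>
    rcases List.mem_cons.1 hz with rfl | hz
    · exact Reach.refl _ _
    · rw [List.isChain_cons_cons] at hl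
      exact (Reach.single hl.1 (hS _ (by simp)) (hS _ (by simp))).trans
        (ih hl.2 (fun x hx => hS x (List.mem_cons_of_mem _ hx)) hz)

theorem _root_.IsDiPath.exists_cons {A : V → V → Prop} {u v : V} {p : List V} (h : IsDiPath A u v p) :
    ∃ l, p = u :: l := by
  obtain ⟨h, -⟩ := h
  cases p with
  | nil => simp at h
  | cons a l => exact ⟨l, by simpa using h⟩

theorem _root_.IsDiPath.last_mem {A : V → V → Prop} {u v : V} {p : List V} (h : IsDiPath A u v p) :
    v ∈ p := List.mem_of_getLast? h.2.1

theorem _root_.IsDiPath.reach {S : Set V} {u v : V} {p : List V} (h : IsDiPath G.Adj u v p)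
    (hS : ∀ x ∈ p, x ∈ S) : Reach G S u v := by
  have hv := IsDiPath.last_mem h
  obtain ⟨l, rfl⟩ := IsDiPath.exists_cons h
  exact reach_of_isChain h.2.2.1 hS hv

theorem connOn_iff {S : Set V} :
    ConnOn G S ↔ S.Nonempty ∧ ∀ u ∈ S, ∀ v ∈ S, Reach G S u v := by
  refine and_congr_right fun _ => forall₄_congr fun u hu v _ => ?_
  exact ⟨fun ⟨p, hp, hS⟩ => IsDiPath.reach hp hS, fun h => h.exists_path hu⟩

theorem _root_.ConnOn.reach {S : Set V} (h : ConnOn G S) {u v : V} (hu : u ∈ S) (hv : v ∈ S) :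
    Reach G S u v := (connOn_iff.1 h).2 u hu v hv

/-- A set is connected as soon as all its vertices reach a single one. -/
theorem connOn_of_reach {S : Set V} {u : V} (hu : u ∈ S) (h : ∀ v ∈ S, Reach G S u v) :
    ConnOn G S :=
  connOn_iff.2 ⟨⟨u, hu⟩, fun a ha b hb => (h a ha).symm.trans (h b hb)⟩

/-- A detour leaving `Q ∪ R` and avoiding `w` either ends in `T` or meets `L`. -/
theorem exists_detour {c w t : V} {Q R L T : Set V} (hcQ : c ∈ Q)
    (h : Reach G {w}ᶜ c t) (ht : t ∈ T) :
    ∃ y ∈ Q ∪ R, ∃ M : Set V, Disjoint M (Q ∪ R ∪ L) ∧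
      (∀ m ∈ insert y M, Reach G (insert y M) y m) ∧
      ((∃ v ∈ insert y M, v ∈ T) ∨ ∃ v ∈ insert y M, ∃ z ∈ L, z ≠ w ∧ G.Adj v z) := by
  by_contra! hcon
  have key : ∀ t, Reach G {w}ᶜ c t → ∃ y ∈ Q ∪ R, ∃ M : Set V, Disjoint M (Q ∪ R ∪ L) ∧
      (∀ m ∈ insert y M, Reach G (insert y M) y m) ∧ t ∈ insert y M := by
    intro t h
    induction h with
    | refl => exact ⟨c, Or.inl hcQ, ∅, by simp, by simp [Reach.refl], by simp⟩
    | @tail b d _ h' ih =>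
      by_cases hd : d ∈ Q ∪ R
      · exact ⟨d, hd, ∅, by simp, by simp [Reach.refl], by simp⟩
      obtain ⟨y, hy, M, hM, hyM, hb⟩ := ih
      have hdL : d ∉ L := fun hdL => (hcon y hy M hM hyM).2 b hb d hdL h'.2.2 h'.1
      refine ⟨y, hy, insert d M, ?_, ?_, by simp⟩
      · rw [Set.disjoint_insert_left]
        exact ⟨fun hh => hh.elim hd hdL, hM⟩
      · have hsub : insert y M ⊆ insert y (insert d M) :=
          Set.insert_subset_insert (Set.subset_insert _ _)
        have hyd : Reach G (insert y (insert d M)) y d :=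
          ((hyM b hb).mono hsub).trans (Reach.single h'.1 (hsub hb) (by simp))
        rintro m (rfl | rfl | hm)
        · exact Reach.refl _ _
        · exact hyd
        · exact (hyM m (Or.inr hm)).mono hsub
  obtain ⟨y, hy, M, hM, hyM, hb⟩ := key t h
  exact (hcon y hy M hM hyM).1 t hb ht

/-- Two connected sets meeting only in `c` and joining `c` to elements of `T`. -/
def HasFan (G : SimpleGraph V) (c : V) (T : Set V) : Prop :=
  ∃ f₁ ∈ T, ∃ f₂ ∈ T, ∃ P Q : Set V, c ∈ P ∧ c ∈ Q ∧ P ∩ Q ⊆ {c} ∧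
    Reach G P c f₁ ∧ Reach G Q c f₂

/-- Connected sets `Q` and `R`, meeting only in `c` and both adjacent to `w`, together with a
simple path `w :: l` ending in `T` and disjoint from both. -/
structure PartialFan (G : SimpleGraph V) (c : V) (T : Set V) (w : V) (l : List V)
    (Q R : Set V) : Prop where
  left_mem : c ∈ Q
  right_mem : c ∈ R
  left_reach : ∀ y ∈ Q, Reach G Q c y
  right_reach : ∀ y ∈ R, Reach G R c y
  inter : Q ∩ R ⊆ {c}
  left_adj : ∃ q ∈ Q, G.Adj q w
  right_adj : ∃ r ∈ R, G.Adj r w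
  chain : (w :: l).IsChain G.Adj
  nodup : (w :: l).Nodup
  last : ∃ t ∈ T, (w :: l).getLast? = some t
  disj : Disjoint {x | x ∈ w :: l} (Q ∪ R)

theorem PartialFan.swap {c w : V} {T Q R : Set V} {l : List V} (h : PartialFan G c T w l Q R) :
    PartialFan G c T w l R Q :=
  ⟨h.right_mem, h.left_mem, h.right_reach, h.left_reach, Set.inter_comm Q R ▸ h.inter,
    h.right_adj, h.left_adj, h.chain, h.nodup, h.last, Set.union_comm Q R ▸ h.disj⟩

/-- A detour from `Q` completes a partial fan or yields one with a shorter tail. -/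
theorem PartialFan.step {c w y : V} {T Q R M : Set V} {l : List V}
    (h : PartialFan G c T w l Q R) (hy : y ∈ Q) (hM : Disjoint M (Q ∪ R ∪ {x | x ∈ w :: l}))
    (hyM : ∀ m ∈ insert y M, Reach G (insert y M) y m)
    (hT : (∃ v ∈ insert y M, v ∈ T) ∨
      ∃ v ∈ insert y M, ∃ z ∈ {x | x ∈ w :: l}, z ≠ w ∧ G.Adj v z) :
    HasFan G c T ∨ ∃ w' l' Q' R', l'.length < l.length ∧ PartialFan G c T w' l' Q' R' := by
  have hsub : insert y M ⊆ Q ∪ M := Set.insert_subset (Or.inl hy) Set.subset_union_right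
  have hQ : ∀ m ∈ Q ∪ M, Reach G (Q ∪ M) c m := by
    rintro m (hm | hm)
    · exact (h.left_reach m hm).mono Set.subset_union_left
    · exact ((h.left_reach y hy).mono Set.subset_union_left).trans
        ((hyM m (Or.inr hm)).mono hsub)
  have hR : ∀ l₁ : List V, (w :: l₁).IsChain G.Adj → ∀ m ∈ R ∪ {x | x ∈ w :: l₁},
      Reach G (R ∪ {x | x ∈ w :: l₁}) c m := by
    rintro l₁ hl m (hm | hm)
    · exact (h.right_reach m hm).mono Set.subset_union_left
    · obtain ⟨r, hr, hrw⟩ := h.right_adj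
      exact ((h.right_reach r hr).mono Set.subset_union_left).trans
        ((Reach.single hrw (Or.inl hr) (Or.inr (by simp))).trans
          (reach_of_isChain hl (fun x hx => Or.inr hx) hm))
  have hdisj := h.disj
  have hinter := h.inter
  simp only [Set.disjoint_left, Set.mem_union, Set.mem_ofPred_eq] at hdisj hM
  rcases hT with ⟨v, hv, hvT⟩ | ⟨v, hv, z, hz, hzw, hvz⟩
  · left
    obtain ⟨t, ht, hlast⟩ := h.last
    refine ⟨v, hvT, t, ht, Q ∪ M, R ∪ {x | x ∈ w :: l}, Or.inl h.left_mem, Or.inl h.right_mem,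
      ?_, hQ v (hsub hv), hR l h.chain t (Or.inr (List.mem_of_getLast? hlast))⟩
    rintro x ⟨hx | hx, hx' | hx'⟩
    · exact hinter ⟨hx, hx'⟩
    · exact absurd (Or.inl hx) (hdisj hx')
    · exact absurd (Or.inl (Or.inr hx')) (hM hx)
    · exact absurd (Or.inr hx') (hM hx)
  · right
    obtain ⟨l₁, l₂, rfl⟩ := List.append_of_mem ((List.mem_cons.1 hz).resolve_left hzw)
    have hch := h.chain
    rw [← List.cons_append, List.isChain_append] at hch
    have hnd := h.nodup
    rw [← List.cons_append, List.nodup_append] at hnd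
    have hmem : ∀ x, x ∈ w :: l₁ ∨ x ∈ z :: l₂ → x ∈ w :: (l₁ ++ z :: l₂) := by
      intro x; simp; tauto
    refine ⟨z, l₂, Q ∪ M, R ∪ {x | x ∈ w :: l₁}, by simp; lia, ⟨Or.inl h.left_mem,
      Or.inl h.right_mem, hQ, hR l₁ hch.1, ?_, ⟨v, hsub hv, hvz⟩, ?_, hch.2.1, hnd.2.1, ?_, ?_⟩⟩
    · rintro x ⟨hx | hx, hx' | hx'⟩
      · exact hinter ⟨hx, hx'⟩
      · exact absurd (Or.inl hx) (hdisj (hmem x (Or.inl hx')))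
      · exact absurd (Or.inl (Or.inr hx')) (hM hx)
      · exact absurd (Or.inr (hmem x (Or.inl hx'))) (hM hx)
    · exact ⟨(w :: l₁).getLast (by simp), Or.inr (List.getLast_mem _),
        hch.2.2 _ (List.getLast?_eq_some_getLast _) z rfl⟩
    · obtain ⟨t, ht, hlast⟩ := h.last
      refine ⟨t, ht, ?_⟩
      rw [← hlast, ← List.cons_append, List.getLast?_append_cons]
    · simp only [Set.disjoint_left, Set.mem_union, Set.mem_ofPred_eq]
      rintro x hx ((hx' | hx') | (hx' | hx'))
      · exact hdisj (hmem x (Or.inr hx)) (Or.inl hx')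
      · exact hM hx' (Or.inr (hmem x (Or.inr hx)))
      · exact hdisj (hmem x (Or.inr hx)) (Or.inr hx')
      · exact hnd.2.2 x hx' x hx rfl

theorem PartialFan.hasFan {c : V} {T : Set V} (hcT : c ∉ T)
    (hT : ∀ x, x ≠ c → ∃ t ∈ T, Reach G {x}ᶜ c t) (n : ℕ) :
    ∀ {w l Q R}, l.length ≤ n → PartialFan G c T w l Q R → HasFan G c T := by
  induction n using Nat.strong_induction_on with
  | _ n ih =>
    intro w l Q R hl h
    have hwc : w ≠ c := by
      rintro rfl
      exact Set.disjoint_left.1 h.disj (by simp) (Or.inl h.left_mem)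
    obtain ⟨t, ht, hct⟩ := hT w hwc
    obtain ⟨y, hy, M, hM, hyM, hv⟩ :=
      exists_detour (R := R) (L := {x | x ∈ w :: l}) h.left_mem hct ht
    have := hy.elim (fun hy => h.step hy hM hyM hv)
      (fun hy => h.swap.step hy (Set.union_comm Q R ▸ hM) hyM hv)
    rcases this with h | ⟨w', l', Q', R', hlt, hshort⟩
    · exact h
    · exact ih l'.length (by lia) le_rfl hshort

/-- The fan version of Menger's theorem for two paths. -/
theorem exists_fan {c : V} {T : Set V} (hcT : c ∉ T) (hne : ∃ t ∈ T, Reach G Set.univ c t)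
    (hT : ∀ x, x ≠ c → ∃ t ∈ T, Reach G {x}ᶜ c t) :
    ∃ f₁ ∈ T, ∃ f₂ ∈ T, f₁ ≠ f₂ ∧ f₁ ≠ c ∧ f₂ ≠ c ∧
      ∃ p q, IsDiPath G.Adj c f₁ p ∧ IsDiPath G.Adj c f₂ q ∧ ∀ x ∈ p, x ∈ q → x = c := by
  obtain ⟨t, ht, hct⟩ := hne
  obtain ⟨p, hp, -⟩ := hct.exists_path (Set.mem_univ _)
  obtain ⟨l, rfl⟩ := IsDiPath.exists_cons hp
  have hfan : HasFan G c T := by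
    obtain ⟨-, hlast, hch, hnd⟩ := hp
    cases l with
    | nil =>
      simp only [List.getLast?_singleton, Option.some.injEq] at hlast
      exact absurd (hlast ▸ ht) hcT
    | cons w l =>
      obtain ⟨hcw, hch⟩ := List.isChain_cons_cons.1 hch
      refine PartialFan.hasFan hcT hT _ le_rfl (w := w) (l := l) (Q := {c}) (R := {c})
        ⟨rfl, rfl, by simp [Reach.refl], by simp [Reach.refl], by simp, ⟨c, rfl, hcw⟩,
          ⟨c, rfl, hcw⟩, hch, (List.nodup_cons.1 hnd).2, ⟨t, ht, ?_⟩, ?_⟩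
      · simpa [List.getLast?_cons_cons] using hlast
      · simpa using (List.nodup_cons.1 hnd).1
  obtain ⟨f₁, hf₁, f₂, hf₂, P, Q, hcP, hcQ, hPQ, h₁, h₂⟩ := hfan
  have hne : ∀ {f}, f ∈ T → f ≠ c := fun hf e => hcT (e ▸ hf)
  obtain ⟨p, hp, hpP⟩ := h₁.exists_path hcP
  obtain ⟨q, hq, hqQ⟩ := h₂.exists_path hcQ
  refine ⟨f₁, hf₁, f₂, hf₂, ?_, hne hf₁, hne hf₂, p, q, hp, hq,
    fun x hx hx' => hPQ ⟨hpP x hx, hqQ x hx'⟩⟩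
  rintro rfl
  exact hne hf₁ (hPQ ⟨h₁.mem hcP, h₂.mem hcQ⟩)

theorem connOn_sdiff_of_not_artOn {S : Set V} {x y : V} (hx : x ∈ S) (hy : y ∈ S) (hxy : y ≠ x)
    (h : ¬ ArtOn G S x) : ConnOn G (S \ {x}) := by
  by_contra hc
  exact h ⟨hx, ⟨y, hy, hxy⟩, hc⟩

/-- Adding to a biconnected set a simple path with ends in it keeps it biconnected: this is
connectedness after removing a set `W` with at most one element. -/
theorem connOn_union_path_sdiff {B W : Set V} {x b : V} {l : List V} (hW : W.Subsingleton)
    (hB : ConnOn G (B \ W)) (hx : x ∈ B) (hb : b ∈ B) (hp : IsDiPath G.Adj x b (x :: l)) :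
    ConnOn G ((B ∪ {z | z ∈ x :: l}) \ W) := by
  obtain ⟨u, hu⟩ := hB.1
  have hsub : B \ W ⊆ (B ∪ {z | z ∈ x :: l}) \ W := Set.sdiff_subset_sdiff_left Set.subset_union_left
  refine connOn_of_reach (hsub hu) ?_
  rintro z ⟨hz | hz, hzW⟩
  · exact (hB.reach hu ⟨hz, hzW⟩).mono hsub
  obtain ⟨-, hlast, hch, hnd⟩ := hp
  obtain ⟨l₁, l₂, e⟩ := List.append_of_mem hz
  have hmem : ∀ y ∈ x :: l, y ∉ W → y ∈ (B ∪ {z | z ∈ x :: l}) \ W :=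
    fun y hy hyW => ⟨Or.inr hy, hyW⟩
  by_cases h : ∃ v ∈ W, v ∈ l₁
  · obtain ⟨v, hvW, hv⟩ := h
    have hW₂ : ∀ y ∈ z :: l₂, y ∉ W := by
      intro y hy hyW
      rw [e, List.nodup_append] at hnd
      exact hnd.2.2 v hv y hy (hW hvW hyW)
    rw [e, List.getLast?_append_cons] at hlast
    have hbz := List.mem_of_getLast? hlast
    have hch₂ : (z :: l₂).IsChain G.Adj := by
      have : (x :: l).IsChain G.Adj := hch
      rw [e] at this
      exact this.right_of_append
    have := reach_of_isChain hch₂ (S := (B ∪ {z | z ∈ x :: l}) \ W)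
      (fun y hy => hmem y (by rw [e]; simp only [List.mem_append]; exact Or.inr hy) (hW₂ y hy)) hbz
    exact ((hB.reach hu ⟨hb, hW₂ b hbz⟩).mono hsub).trans this.symm
  · push Not at h
    have hW₁ : ∀ y ∈ l₁ ++ [z], y ∉ W := by
      intro y hy hyW
      rcases List.mem_append.1 hy with hy | hy
      · exact h y hyW hy
      · rw [List.mem_singleton] at hy
        exact hzW (hy ▸ hyW)
    have hch₁ : (l₁ ++ [z]).IsChain G.Adj := by
      have : (x :: l).IsChain G.Adj := hch
      rw [e, List.append_cons] at this
      exact this.left_of_append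
    obtain ⟨l₃, e₃⟩ : ∃ l₃, l₁ ++ [z] = x :: l₃ := by
      cases l₁ with
      | nil => exact ⟨[], by simp at e; simp [e.1]⟩
      | cons a l₁ => exact ⟨l₁ ++ [z], by simp at e; simp [e.1]⟩
    have hsub₁ : ∀ y ∈ l₁ ++ [z], y ∈ x :: l := by
      intro y hy
      rw [e, List.append_cons]
      exact List.mem_append_left _ hy
    have hzmem : z ∈ l₁ ++ [z] := by simp
    rw [e₃] at hch₁ hsub₁ hW₁ hzmem
    have := reach_of_isChain hch₁ (S := (B ∪ {z | z ∈ x :: l}) \ W)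
      (fun y hy => hmem y (hsub₁ y hy) (hW₁ y hy)) hzmem
    exact ((hB.reach hu ⟨hx, hW₁ x (by simp)⟩).mono hsub).trans this

/-- A vertex of a block which is not an articulation point has all its neighbours in the block. -/
theorem _root_.BlockOn.mem_of_adj {S B : Set V} {x y : V} (h : BlockOn G S B) (hx : x ∈ B)
    (hxa : ¬ ArtOn G S x) (hy : y ∈ S) (hxy : G.Adj x y) : y ∈ B := by
  obtain ⟨hBS, ⟨hB, hB'⟩, hmax⟩ := h
  obtain ⟨b, hb, hbx⟩ := (hB' x hx).1
  have hyS : y ∈ S \ {x} := ⟨hy, hxy.ne'⟩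
  obtain ⟨p, hp, hpS⟩ := ((connOn_sdiff_of_not_artOn (hBS hx) hy hxy.ne' hxa).reach hyS
    ⟨hBS hb, hbx⟩).exists_path hyS
  obtain ⟨l, rfl⟩ := IsDiPath.exists_cons hp
  have hp' : IsDiPath G.Adj x b (x :: y :: l) := by
    obtain ⟨-, h₂, h₃, h₄⟩ := hp
    exact ⟨rfl, by rwa [List.getLast?_cons_cons], List.isChain_cons_cons.2 ⟨hxy, h₃⟩,
      List.nodup_cons.2 ⟨fun hm => (hpS x hm).2 rfl, h₄⟩⟩
  have hW : ∀ W : Set V, W.Subsingleton → ConnOn G (B \ W) →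
      ConnOn G ((B ∪ {z | z ∈ x :: y :: l}) \ W) :=
    fun W hW hBW => connOn_union_path_sdiff hW hBW hx hb hp'
  rw [← hmax (B ∪ {z | z ∈ x :: y :: l}) Set.subset_union_left ?_ ⟨?_, ?_⟩]
  · exact Or.inr (by simp)
  · refine Set.union_subset hBS fun z hz => ?_
    rcases List.mem_cons.1 hz with rfl | hz
    · exact hBS hx
    · exact (hpS z hz).1
  · simpa using hW ∅ Set.subsingleton_empty (by simpa using hB)
  · intro v _
    refine hW {v} Set.subsingleton_singleton ?_
    by_cases hv : v ∈ B
    · exact hB' v hv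
    · rwa [Set.sdiff_singleton_eq_self hv]

/-- The articulation point of a leaf component is its only noninternal vertex, and it separates
the internal vertices from the rest. -/
theorem _root_.LeafCompOn.exists_art {S B : Set V} (h : LeafCompOn G S B) :
    ∃ a ∈ B, ArtOn G S a ∧ (∀ x, InternalOn G S B x ↔ x ∈ B ∧ x ≠ a) ∧
      ∀ x ∈ B, x ≠ a → ∀ y ∈ S, G.Adj x y → y ∈ B := by
  obtain ⟨hB, a, ⟨haB, ha⟩, huniq⟩ := h
  have hinner : ∀ x ∈ B, x ≠ a → ¬ ArtOn G S x := fun x hx hxa hx' => hxa (huniq x ⟨hx, hx'⟩)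
  refine ⟨a, haB, ha, fun x => ⟨fun hx => ⟨hx.1, ?_⟩, fun hx => ⟨hx.1, hinner x hx.1 hx.2⟩⟩,
    fun x hx hxa y hy hxy => BlockOn.mem_of_adj hB hx (hinner x hx hxa) hy hxy⟩
  rintro rfl
  exact hx.2 ha

theorem _root_.BiconnOn.connOn_sdiff {B : Set V} (h : BiconnOn G B) (v : V) : ConnOn G (B \ {v}) := by
  by_cases hv : v ∈ B
  · exact h.2 v hv
  · rw [Set.sdiff_singleton_eq_self hv]
    exact h.1

theorem _root_.LeafCompOn.subset_of_internalOn {S B B' : Set V} {x : V} (h : LeafCompOn G S B)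
    (h' : LeafCompOn G S B') (hx : InternalOn G S B x) (hx' : x ∈ B') : B' ⊆ B := by
  obtain ⟨a, haB, -, hinner, hadj⟩ := LeafCompOn.exists_art h
  have hxa := (hinner x).1 hx
  intro z hz
  by_cases hza : z = a
  · exact hza ▸ haB
  · refine (((BiconnOn.connOn_sdiff h'.1.2.1 a).reach ⟨hx', hxa.2⟩ ⟨hz, hza⟩).mem_of_closed
      (X := B \ {a}) hxa ?_).1
    exact fun y hy _ w hw hyw => ⟨hadj y hy.1 hy.2 w (h'.1.1 hw.1) hyw, hw.2⟩

/-- Distinct leaf components have no common internal vertex. -/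
theorem _root_.LeafCompOn.eq_of_internalOn {S B B' : Set V} {x : V} (h : LeafCompOn G S B)
    (h' : LeafCompOn G S B') (hx : InternalOn G S B x) (hxB : InternalOn G S B' x) : B = B' :=
  (LeafCompOn.subset_of_internalOn h' h hxB hx.1).antisymm
    (LeafCompOn.subset_of_internalOn h h' hx hxB.1)

/-- If the component of `u` in `S \ {x}` has no articulation point of `S`, then together with `x`
it is a leaf component. -/
theorem leafCompOn_insert_component {S : Set V} (hS : ConnOn G S) {x u : V} (hx : ArtOn G S x)
    (hu : u ∈ S \ {x}) (hK : ∀ y, Reach G (S \ {x}) u y → ¬ ArtOn G S y) :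
    LeafCompOn G S (insert x {v | Reach G (S \ {x}) u v}) := by
  set K := {v | Reach G (S \ {x}) u v}
  have hKS : K ⊆ S \ {x} := fun v hv => Reach.mem hv hu
  have huK : u ∈ K := Reach.refl _ _
  have hBS : insert x K ⊆ S := Set.insert_subset hx.1 fun v hv => (hKS hv).1
  have hadj : ∀ z ∈ K, ∀ w ∈ S, w ∉ K → G.Adj z w → w = x := by
    intro z hz w hw hwK hzw
    by_contra hwx
    exact hwK (Reach.trans hz (Reach.single hzw (hKS hz) ⟨hw, hwx⟩))
  have hconn : ∀ A ⊆ S, x ∈ A → ConnOn G A → ConnOn G (insert x K ∩ A) := by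
    classical
    intro A hA hxA hconn
    refine connOn_of_reach (u := x) ⟨Or.inl rfl, hxA⟩ ?_
    rintro v ⟨hv, hvA⟩
    have hxK : x ∉ K := fun hxK => (hKS hxK).2 rfl
    have := (hconn.reach hxA hvA).map (T := insert x K ∩ A) (fun z => if z ∈ K then z else x) ?_
    · rcases hv with rfl | hv
      · exact Reach.refl _ _
      · simpa [hxK, hv] using this
    · intro z hz w hw hzw
      by_cases hzK : z ∈ K <;> by_cases hwK : w ∈ K
      · simp [hzK, hwK, hzw, hz, hw]
      · have := hadj z hzK w (hA hw) hwK hzw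
        subst this
        simp [hzK, hwK, hzw, hz, hw]
      · have := hadj w hwK z (hA hz) hzK hzw.symm
        subst this
        simp [hzK, hwK, hzw, hz, hw]
      · simp [hzK, hwK]
  have hKx : insert x K \ {x} = K := by
    ext v
    simp only [Set.mem_sdiff, Set.mem_insert_iff, Set.mem_singleton_iff]
    exact ⟨fun h => h.1.resolve_left h.2, fun h => ⟨Or.inr h, (hKS h).2⟩⟩
  refine ⟨⟨hBS, ⟨?_, ?_⟩, ?_⟩, x, ⟨Or.inl rfl, hx⟩, ?_⟩
  · simpa [Set.inter_eq_left.2 hBS] using hconn S subset_rfl hx.1 hS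
  · rintro v (rfl | hv)
    · rw [hKx]
      exact connOn_of_reach huK fun w hw => Reach.component hw
    · have hvx : x ≠ v := fun e => (hKS hv).2 e.symm
      have := hconn (S \ {v}) Set.sdiff_subset ⟨hx.1, hvx⟩
        (connOn_sdiff_of_not_artOn (hKS hv).1 hx.1 hvx (hK v hv))
      rwa [← Set.inter_sdiff_assoc, Set.inter_eq_left.2 hBS] at this
  · intro B' hB hB'S hB'
    refine Set.Subset.antisymm (fun v hv => ?_) hB
    by_cases hvx : v = x
    · exact Or.inl hvx
    · exact Or.inr (((hB'.2 x (hB (Or.inl rfl))).reach ⟨hB (Or.inr huK), hu.2⟩ ⟨hv, hvx⟩).mono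
        (Set.sdiff_subset_sdiff_left hB'S))
  · rintro y ⟨rfl | hy, hya⟩
    · rfl
    · exact absurd hya (hK y hy)

/-- Every component left after deleting an articulation point contains the internal vertices of
some leaf component. -/
theorem exists_leafCompOn [Finite V] {S : Set V} (hS : ConnOn G S) {x u : V} (hx : ArtOn G S x)
    (hu : u ∈ S \ {x}) :
    ∃ B, LeafCompOn G S B ∧ ∀ v, InternalOn G S B v → Reach G (S \ {x}) u v := by
  induction hn : {v | Reach G (S \ {x}) u v}.ncard using Nat.strong_induction_on
    generalizing x u with
  | _ n ih =>
    by_cases hK : ∃ y, Reach G (S \ {x}) u y ∧ ArtOn G S y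
    · obtain ⟨y, huy, hy⟩ := hK
      have hyS := huy.mem hu
      have hxy : x ≠ y := fun e => hyS.2 e.symm
      obtain ⟨u', hu', hxu'⟩ : ∃ u' ∈ S \ {y}, ¬ Reach G (S \ {y}) x u' := by
        by_contra! hc
        exact hy.2.2 (connOn_of_reach ⟨hx.1, hxy⟩ hc)
      have hsub : ∀ v, Reach G (S \ {y}) u' v → v ∈ S \ {x} := fun v hv =>
        ⟨(hv.mem hu').1, by rintro rfl; exact hxu' hv.symm⟩
      have hKK : ∀ v, Reach G (S \ {y}) u' v → Reach G (S \ {x}) u v := by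
        intro v hv
        obtain ⟨z, hz, hu'z, hzy⟩ := (hS.reach hu'.1 hyS.1).exists_adj_of_ne hu'.2
        exact huy.trans ((Reach.single hzy.symm hyS (hsub z hu'z)).trans
          ((hu'z.component.mono hsub).symm.trans (hv.component.mono hsub)))
      obtain ⟨B, hB, hBi⟩ := ih _ (by
        rw [← hn]
        refine Set.ncard_lt_ncard ⟨hKK, fun hss => ?_⟩
        exact (Reach.mem (hss huy) hu').2 rfl) hy hu' rfl
      exact ⟨B, hB, fun v hv => hKK v (hBi v hv)⟩
    · push Not at hK
      refine ⟨_, leafCompOn_insert_component hS hx hu hK, ?_⟩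
      rintro v ⟨rfl | hv, hva⟩
      · exact absurd hx hva
      · exact hv

/-- `r` retracts `G` onto `S`, and edges between distinct fibres lie in `S`. -/
structure Retracts (G : SimpleGraph V) (S : Set V) (r : V → V) : Prop where
  mem : ∀ x, r x ∈ S
  id : ∀ x ∈ S, r x = x
  adj : ∀ x y, G.Adj x y → r x ≠ r y → x ∈ S ∧ y ∈ S

theorem Retracts.connOn {S : Set V} {r : V → V} (h : Retracts G S r) (hG : G.Connected) :
    ConnOn G S := by
  obtain ⟨x⟩ := hG.nonempty
  refine connOn_of_reach (h.mem x) fun v hv => ?_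
  have huniv : Reach G Set.univ x v := by
    obtain ⟨p⟩ := hG.preconnected x v
    induction p with
    | nil => exact Reach.refl _ _
    | cons h p ih => exact (Reach.single h (Set.mem_univ _) (Set.mem_univ _)).trans (ih hv)
  have := huniv.map (T := S) r fun a _ b _ hab => ?_
  · rwa [h.id v hv] at this
  · by_cases e : r a = r b
    · exact Or.inl e
    · obtain ⟨ha, hb⟩ := h.adj a b hab e
      rw [h.id a ha, h.id b hb]
      exact Or.inr ⟨hab, ha, hb⟩

/-- Contracting a subset `D` of `S` to a vertex `a` preserves retractions, if `D` has no other
neighbours in `S`. -/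
theorem Retracts.sdiff {S D : Set V} {r : V → V} {a : V} (h : Retracts G S r) (ha : a ∈ S \ D)
    (hD : ∀ x ∈ D, x ∈ S → ∀ y ∈ S, G.Adj x y → y ∈ D ∨ y = a) :
    ∃ r', Retracts G (S \ D) r' := by
  classical
  refine ⟨fun x => if r x ∈ D then a else r x, fun x => ?_, fun x hx => ?_, fun x y hxy hne => ?_⟩
  · split_ifs with hx
    · exact ha
    · exact ⟨h.mem x, hx⟩
  · simp [h.id x hx.1, hx.2]
  · have hr : r x ≠ r y := fun e => hne (by simp [e])
    obtain ⟨hx, hy⟩ := h.adj x y hxy hr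
    simp only [h.id x hx, h.id y hy] at hne
    refine ⟨⟨hx, fun hxD => ?_⟩, ⟨hy, fun hyD => ?_⟩⟩
    · rcases hD x hxD hx y hy hxy with hyD | rfl <;> simp_all
    · rcases hD y hyD hy x hx hxy.symm with hxD | rfl <;> simp_all

theorem _root_.LeafOn.exists_adj {S : Set V} {v : V} (h : LeafOn G S v) :
    ∃ u ∈ S, G.Adj v u ∧ ∀ w ∈ S, G.Adj v w → w = u := by
  obtain ⟨u, hu⟩ := Set.ncard_eq_one.1 h.2
  have hmem : ∀ w, w ∈ S ∧ G.Adj v w ↔ w = u := fun w => by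
    simpa using Set.ext_iff.1 hu w
  exact ⟨u, ((hmem u).2 rfl).1, ((hmem u).2 rfl).2, fun w hw hvw => (hmem w).1 ⟨hw, hvw⟩⟩

theorem _root_.PruneStep.retracts {C S S' : Set V} {r : V → V} (hs : PruneStep G C S S')
    (h : Retracts G S r) : ∃ r', Retracts G S' r' := by
  cases hs with
  | leaf hv hvC hl =>
    obtain ⟨u, hu, hvu, huniq⟩ := LeafOn.exists_adj hl
    refine h.sdiff (a := u) ⟨hu, hvu.ne'⟩ ?_
    rintro x rfl _ y hy hxy
    exact Or.inr (huniq y hy hxy)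
  | @comp B hB hC =>
    obtain ⟨a, haB, ha, hinner, hadj⟩ := LeafCompOn.exists_art hB
    refine h.sdiff (a := a) ⟨ha.1, fun hi => hi.2 ha⟩ ?_
    intro x hx _ y hy hxy
    have hx := (hinner x).1 hx
    by_cases hya : y = a
    · exact Or.inr hya
    · exact Or.inl ((hinner y).2 ⟨hadj x hx.1 hx.2 y hy hxy, hya⟩)

theorem _root_.PruneStep.customers_subset {C S S' : Set V} (hs : PruneStep G C S S') (h : C ⊆ S) :
    C ⊆ S' := by
  cases hs with
  | leaf hv hvC hl => exact fun c hc => ⟨h hc, by rintro rfl; exact hvC hc⟩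
  | comp hB hC => exact fun c hc => ⟨h hc, fun hi => hC c hi hc⟩

theorem _root_.Pruned.exists_retracts {C S : Set V} (h : Pruned G C S) :
    C ⊆ S ∧ ∃ r, Retracts G S r := by
  obtain ⟨h, -⟩ := h
  induction h with
  | refl => exact ⟨Set.subset_univ _, id, fun _ => trivial, fun _ _ => rfl, fun _ _ _ _ => by simp⟩
  | tail _ hs ih =>
    obtain ⟨hC, r, hr⟩ := ih
    exact ⟨PruneStep.customers_subset hs hC, PruneStep.retracts hs hr⟩

/-- Every path-disjoint cover has a member attached to each leaf component with an internal
customer. -/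
theorem exists_mem_cover_internalOn {C S B F' : Set V} {r : V → V} {p : V} (hr : Retracts G S r)
    (hB : LeafCompOn G S B) (hp : InternalOn G S B p) (hpC : p ∈ C) (hF : UPDCover G C F') :
    ∃ f ∈ F', InternalOn G S B (r f) := by
  obtain ⟨a, haB, ha, hinner, hadj⟩ := LeafCompOn.exists_art hB
  have hpB := (hinner p).1 hp
  have hrp := hr.id p (hB.1.1 hpB.1)
  have key : ∀ f, Reach G {a}ᶜ p f → InternalOn G S B (r f) := by
    intro f hf
    refine hf.mem_of_closed (X := {x | InternalOn G S B (r x)}) (by simpa [hrp] using hp) ?_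
    intro x hx _ y hya hxy
    rw [Set.mem_ofPred_eq] at hx ⊢
    by_cases e : r x = r y
    · rwa [← e]
    · obtain ⟨hxS, hyS⟩ := hr.adj x y hxy e
      rw [hr.id x hxS, hinner] at hx
      rw [hr.id y hyS, hinner]
      exact ⟨hadj x hx.1 hx.2 y hyS hxy, hya⟩
  by_cases hpF : p ∈ F'
  · exact ⟨p, hpF, by rwa [hrp]⟩
  obtain ⟨f₁, hf₁, f₂, hf₂, -, -, -, P, Q, hP, hQ, hPQ⟩ := hF p hpC hpF
  by_cases haP : a ∈ P
  · have haQ : a ∉ Q := fun haQ => hpB.2 (hPQ a haP haQ).symm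
    exact ⟨f₂, hf₂, key f₂ (IsDiPath.reach hQ fun x hx hxa => haQ (hxa ▸ hx))⟩
  · exact ⟨f₁, hf₁, key f₁ (IsDiPath.reach hP fun x hx hxa => haP (hxa ▸ hx))⟩

/-- A leaf whose neighbour is not an articulation point spans, with it, the whole graph. -/
theorem _root_.LeafOn.eq_pair {S : Set V} {u v : V} (h : LeafOn G S v) (hu : u ∈ S) (hvu : G.Adj v u)
    (huniq : ∀ w ∈ S, G.Adj v w → w = u) (hua : ¬ ArtOn G S u) : S = {v, u} := by
  refine Set.Subset.antisymm (fun w hw => ?_) (Set.insert_subset h.1 (Set.singleton_subset_iff.2 hu))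
  by_cases hwu : w = u
  · exact Or.inr hwu
  · left
    refine ((connOn_sdiff_of_not_artOn hu h.1 hvu.ne hua).reach ⟨h.1, hvu.ne⟩
      ⟨hw, hwu⟩).mem_of_closed (X := {v}) rfl ?_
    rintro x rfl _ y hy hxy
    exact absurd (huniq y hy.1 hxy) hy.2

theorem connOn_singleton (u : V) : ConnOn G {u} :=
  connOn_of_reach rfl (by rintro v rfl; exact Reach.refl _ _)

theorem not_artOn_pair {u v x : V} (huv : v ≠ u) : ¬ ArtOn G {v, u} x := by
  rintro ⟨rfl | rfl, -, h⟩
  · exact h (by simpa [Set.insert_sdiff_of_mem, huv] using connOn_singleton u)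
  · exact h (by simpa [Set.insert_sdiff_of_notMem, huv] using connOn_singleton v)

/-- A leaf adjacent to an articulation point is the internal vertex of some leaf component. -/
theorem _root_.LeafOn.exists_leafCompOn [Finite V] {S : Set V} {u v : V} (h : LeafOn G S v)
    (hS : ConnOn G S) (hvu : G.Adj v u) (huniq : ∀ w ∈ S, G.Adj v w → w = u)
    (hua : ArtOn G S u) : ∃ B, LeafCompOn G S B ∧ ∀ x, InternalOn G S B x → x = v := by
  obtain ⟨B, hB, hBi⟩ := PrunedCover.exists_leafCompOn hS hua ⟨h.1, hvu.ne⟩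
  refine ⟨B, hB, fun x hx => (hBi x hx).mem_of_closed (X := {v}) rfl ?_⟩
  rintro x rfl _ y hy hxy
  exact absurd (huniq y hy.1 hxy) hy.2

/-- A set meeting the interior of every leaf component is a cover, as soon as there is an
articulation point. -/
theorem updCover_of_internalOn [Finite V] {C S F : Set V} (hS : ConnOn G S) (hCS : C ⊆ S)
    (hart : ∃ x, ArtOn G S x) (hF : ∀ B, LeafCompOn G S B → ∃ f ∈ F, InternalOn G S B f) :
    UPDCover G C F := by
  have hreach : ∀ x u, ArtOn G S x → u ∈ S \ {x} → ∃ f ∈ F, Reach G (S \ {x}) u f := by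
    intro x u hx hu
    obtain ⟨B, hB, hBi⟩ := exists_leafCompOn hS hx hu
    obtain ⟨f, hf, hfi⟩ := hF B hB
    exact ⟨f, hf, hBi f hfi⟩
  have havoid : ∀ y, ∃ f ∈ F, f ∈ S ∧ f ≠ y := by
    intro y
    obtain ⟨x, hx⟩ := hart
    obtain ⟨u, hu⟩ := hx.2.1
    obtain ⟨v, hv, huv⟩ : ∃ v ∈ S \ {x}, ¬ Reach G (S \ {x}) u v := by
      by_contra! hc
      exact hx.2.2 (connOn_of_reach hu hc)
    obtain ⟨f, hf, huf⟩ := hreach x u hx hu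
    obtain ⟨f', hf', hvf'⟩ := hreach x v hx hv
    by_cases hfy : f = y
    · refine ⟨f', hf', (hvf'.mem hv).1, ?_⟩
      rintro rfl
      exact huv (huf.trans (hfy ▸ hvf'.symm))
    · exact ⟨f, hf, (huf.mem hu).1, hfy⟩
  intro c hc hcF
  have hcS := hCS hc
  refine exists_fan hcF ?_ fun y hy => ?_
  · obtain ⟨f, hf, hfS, -⟩ := havoid c
    exact ⟨f, hf, (hS.reach hcS hfS).mono (Set.subset_univ _)⟩
  · have hsub : S \ {y} ⊆ {y}ᶜ := fun z hz => hz.2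
    by_cases hyS : y ∈ S
    · by_cases hya : ArtOn G S y
      · obtain ⟨f, hf, hcf⟩ := hreach y c hya ⟨hcS, hy.symm⟩
        exact ⟨f, hf, hcf.mono hsub⟩
      · obtain ⟨f, hf, hfS, hfy⟩ := havoid y
        exact ⟨f, hf, ((connOn_sdiff_of_not_artOn hyS hcS hy.symm hya).reach ⟨hcS, hy.symm⟩
          ⟨hfS, hfy⟩).mono hsub⟩
    · obtain ⟨f, hf, hfS, -⟩ := havoid c
      refine ⟨f, hf, (hS.reach hcS hfS).mono ?_⟩
      rintro z hz rfl
      exact hyS hz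

/-- A cover of at least two customers has at least two members. -/
theorem _root_.UPDCover.one_lt_ncard [Finite V] {C F' : Set V} {u v : V} (h : UPDCover G C F')
    (hu : u ∈ C) (hv : v ∈ C) (huv : u ≠ v) : 1 < F'.ncard := by
  rw [Set.one_lt_ncard]
  by_cases hu' : u ∈ F'
  · by_cases hv' : v ∈ F'
    · exact ⟨u, hu', v, hv', huv⟩
    · obtain ⟨f₁, hf₁, f₂, hf₂, hne, -⟩ := h v hv hv'
      exact ⟨f₁, hf₁, f₂, hf₂, hne⟩
  · obtain ⟨f₁, hf₁, f₂, hf₂, hne, -⟩ := h u hu hu'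
    exact ⟨f₁, hf₁, f₂, hf₂, hne⟩

theorem _root_.Pruned.leaf_mem {C S : Set V} {v : V} (h : Pruned G C S) (hv : LeafOn G S v) :
    v ∈ C := by
  by_contra hvC
  exact h.2 _ (PruneStep.leaf hv.1 hvC hv)

theorem leafOn_pair {u v : V} (huv : G.Adj v u) : LeafOn G {v, u} u := by
  refine ⟨Or.inr rfl, Set.ncard_eq_one.2 ⟨v, ?_⟩⟩
  ext w
  constructor
  · rintro ⟨rfl | rfl, hw⟩
    · rfl
    · exact absurd hw G.irrefl
  · rintro rfl
    exact ⟨Or.inl rfl, huv.symm⟩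

end PrunedCover

/-- Let `G` be a connected graph with customers `C` contained in the
facility set, and let `G*` (with vertex set `Vstar`) be the pruned graph. Suppose `G*`
has a leaf or a leaf component, and let `F*` consist of all leaves of `G*` together
with one internal customer picked from each leaf component of `G*`. Then `F*` is an
unconstrained path-disjoint cover of `C` of minimum cardinality. -/
theorem pruned_graph_optimal_unconstrained_cover
    {V : Type*} [Fintype V] (G : SimpleGraph V) (hG : G.Connected)
    (C F : Set V) (hCF : C ⊆ F)
    (Vstar : Set V) (hVstar : Pruned G C Vstar)
    (hleaf : (∃ v, LeafOn G Vstar v) ∨ (∃ B, LeafCompOn G Vstar B))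
    (pick : ∀ B : Set V, LeafCompOn G Vstar B → V)
    (hpick : ∀ B hB, InternalOn G Vstar B (pick B hB) ∧ pick B hB ∈ C)
    (Fstar : Set V)
    (hFstar : Fstar =
      {v | LeafOn G Vstar v} ∪ {x | ∃ B, ∃ hB : LeafCompOn G Vstar B, pick B hB = x}) :
    UPDCover G C Fstar ∧ ∀ F', UPDCover G C F' → Fstar.ncard ≤ F'.ncard := by

  open PrunedCover in
  obtain ⟨hCS, r, hr⟩ := Pruned.exists_retracts hVstar
  have hS : ConnOn G Vstar := hr.connOn hG
  by_cases hart : ∃ x, ArtOn G Vstar x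
  · have hpicks : ∀ x ∈ Fstar, ∃ B, ∃ hB : LeafCompOn G Vstar B, pick B hB = x := by
      intro v hv
      rw [hFstar] at hv
      refine hv.elim (fun hv => ?_) id
      obtain ⟨u, hu, hvu, huniq⟩ := LeafOn.exists_adj hv
      have hua : ArtOn G Vstar u := by
        by_contra hua
        obtain ⟨x, hx⟩ := hart
        rw [LeafOn.eq_pair hv hu hvu huniq hua] at hx
        exact not_artOn_pair hvu.ne hx
      obtain ⟨B, hB, hBi⟩ := LeafOn.exists_leafCompOn hv hS hvu huniq hua
      exact ⟨B, hB, hBi _ (hpick B hB).1⟩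
    refine ⟨updCover_of_internalOn hS hCS hart fun B hB => ⟨pick B hB, ?_, (hpick B hB).1⟩,
      fun F' hF' => ?_⟩
    · rw [hFstar]
      exact Or.inr ⟨B, hB, rfl⟩
    · have hmem : ∀ x ∈ Fstar, ∃ f ∈ F', ∃ B, ∃ hB : LeafCompOn G Vstar B,
          pick B hB = x ∧ InternalOn G Vstar B (r f) := by
        intro x hx
        obtain ⟨B, hB, hBx⟩ := hpicks x hx
        obtain ⟨f, hf, hfB⟩ :=
          exists_mem_cover_internalOn hr hB (hpick B hB).1 (hpick B hB).2 hF'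
        exact ⟨f, hf, B, hB, hBx, hfB⟩
      choose! f hf B hB hBx hfB using hmem
      refine Set.ncard_le_ncard_of_injOn f hf fun x hx y hy hxy => ?_
      have hBxy : B x = B y :=
        LeafCompOn.eq_of_internalOn (hB x hx) (hB y hy) (hfB x hx) (hxy ▸ hfB y hy)
      rw [← hBx x hx, ← hBx y hy]
      congr 1
  · obtain ⟨v, hv⟩ := hleaf.resolve_right fun ⟨B, hB⟩ => by
      obtain ⟨a, -, ha, -⟩ := LeafCompOn.exists_art hB
      exact hart ⟨a, ha⟩
    obtain ⟨u, hu, hvu, huniq⟩ := LeafOn.exists_adj hv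
    have hpair := LeafOn.eq_pair hv hu hvu huniq fun hua => hart ⟨u, hua⟩
    have hu' : LeafOn G Vstar u := by
      rw [hpair]
      exact leafOn_pair hvu
    have hFS : Fstar ⊆ Vstar := by
      rw [hFstar]
      rintro x (hx | ⟨B, hB, rfl⟩)
      · exact hx.1
      · exact hB.1.1 (hpick B hB).1.1
    have hSF : Vstar ⊆ Fstar := by
      rw [hFstar]
      intro x hx
      rw [hpair] at hx
      rcases hx with rfl | rfl
      · exact Or.inl hv
      · exact Or.inl hu'
    refine ⟨fun c hc hcF => absurd (hSF (hCS hc)) hcF, fun F' hF' => ?_⟩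
    calc Fstar.ncard ≤ Vstar.ncard := Set.ncard_le_ncard hFS
      _ = 2 := by rw [hpair, Set.ncard_pair hvu.ne]
      _ ≤ F'.ncard := UPDCover.one_lt_ncard hF' (Pruned.leaf_mem hVstar hv)
          (Pruned.leaf_mem hVstar hu') hvu.ne
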